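/- Let (X, Δ, ε) be a cocommutative coalgebra over a commutative ring k and let T : X⊗X⊗X → X be an invertible ternary self-distributive coalgebra morphism. Define β, β' : X^{⊗4} → X^{⊗4} by β(x⊗x'⊗y⊗z) = y⁽¹⁾ ⊗ z⁽¹⁾ ⊗ T(x⊗y⁽²⁾⊗z⁽²⁾) ⊗ T(x'⊗y⁽³⁾⊗z⁽³⁾) and β'(y⊗z⊗x⊗x') = T(x⊗z⁽²⁾⊗y⁽²⁾) ⊗ T(x'⊗z⁽³⁾⊗y⁽³⁾) ⊗ y⁽¹⁾ ⊗ z⁽¹⁾. Then β ∘ β' = id and β' ∘ β = id on X^{⊗4}; in particular β is invertible with inverse β'. -/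

import Mathlib

open TensorProduct

/-- The finite family `(x1 i) ⊗ (x2 i)` represents the comultiplication of `x`. -/
def Rep2 (k : Type*) {X : Type*} [CommRing k] [AddCommMonoid X] [Module k X] [Coalgebra k X]
    (x : X) {n : ℕ} (x1 x2 : Fin n → X) : Prop :=
  Coalgebra.comul (R := k) x = ∑ i, x1 i ⊗ₜ[k] x2 i

/-- The twofold iterated comultiplication `x ↦ x⁽¹⁾ ⊗ (x⁽²⁾ ⊗ x⁽³⁾)`. -/
noncomputable def delta3 (k : Type*) {X : Type*} [CommRing k] [AddCommMonoid X] [Module k X]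
    [Coalgebra k X] : X →ₗ[k] X ⊗[k] (X ⊗[k] X) :=
  (LinearMap.lTensor X (Coalgebra.comul (R := k))) ∘ₗ Coalgebra.comul

/-- The finite family `(x1 i) ⊗ (x2 i) ⊗ (x3 i)` represents the iterated comultiplication
`x⁽¹⁾ ⊗ x⁽²⁾ ⊗ x⁽³⁾` of `x`. -/
def Rep3 (k : Type*) {X : Type*} [CommRing k] [AddCommMonoid X] [Module k X] [Coalgebra k X]
    (x : X) {n : ℕ} (x1 x2 x3 : Fin n → X) : Prop :=
  delta3 k x = ∑ i, x1 i ⊗ₜ[k] (x2 i ⊗ₜ[k] x3 i)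

/-- `T` is ternary self-distributive. -/
def IsTSD (k : Type*) {X : Type*} [CommRing k] [AddCommMonoid X] [Module k X] [Coalgebra k X]
    (T : X ⊗[k] (X ⊗[k] X) →ₗ[k] X) : Prop :=
  ∀ (x y z u v : X) {n m : ℕ} (u1 u2 u3 : Fin n → X) (v1 v2 v3 : Fin m → X),
    Rep3 k u u1 u2 u3 → Rep3 k v v1 v2 v3 →
    T (T (x ⊗ₜ[k] (y ⊗ₜ[k] z)) ⊗ₜ[k] (u ⊗ₜ[k] v)) =
      ∑ i, ∑ j, T (T (x ⊗ₜ[k] (u1 i ⊗ₜ[k] v1 j)) ⊗ₜ[k]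
        (T (y ⊗ₜ[k] (u2 i ⊗ₜ[k] v2 j)) ⊗ₜ[k] T (z ⊗ₜ[k] (u3 i ⊗ₜ[k] v3 j))))

/-- `T` is invertible. -/
def IsInvertibleTSD (k : Type*) {X : Type*} [CommRing k] [AddCommMonoid X] [Module k X]
    [Coalgebra k X] (T : X ⊗[k] (X ⊗[k] X) →ₗ[k] X) : Prop :=
  ∀ (x y z : X) {n m : ℕ} (y1 y2 : Fin n → X) (z1 z2 : Fin m → X),
    Rep2 k y y1 y2 → Rep2 k z z1 z2 →
    ∑ i, ∑ j, T (T (x ⊗ₜ[k] (y2 i ⊗ₜ[k] z2 j)) ⊗ₜ[k] (z1 j ⊗ₜ[k] y1 i)) =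
      (Coalgebra.counit (R := k) y * Coalgebra.counit (R := k) z) • x

/-- `T` is a coalgebra morphism. -/
def IsCoalgMor (k : Type*) {X : Type*} [CommRing k] [AddCommMonoid X] [Module k X]
    [Coalgebra k X] (T : X ⊗[k] (X ⊗[k] X) →ₗ[k] X) : Prop :=
  (∀ x y z : X, Coalgebra.counit (R := k) (T (x ⊗ₜ[k] (y ⊗ₜ[k] z))) =
      Coalgebra.counit (R := k) x * Coalgebra.counit (R := k) y * Coalgebra.counit (R := k) z) ∧
  (∀ (x y z : X) {n₁ n₂ n₃ : ℕ} (x1 x2 : Fin n₁ → X) (y1 y2 : Fin n₂ → X) (z1 z2 : Fin n₃ → X),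
    Rep2 k x x1 x2 → Rep2 k y y1 y2 → Rep2 k z z1 z2 →
    Coalgebra.comul (R := k) (T (x ⊗ₜ[k] (y ⊗ₜ[k] z))) =
      ∑ i, ∑ j, ∑ l, T (x1 i ⊗ₜ[k] (y1 j ⊗ₜ[k] z1 l)) ⊗ₜ[k] T (x2 i ⊗ₜ[k] (y2 j ⊗ₜ[k] z2 l)))

open Coalgebra in
/-- The endomorphism `c ⊗ m ↦ c⁽¹⁾ ⊗ f(c⁽²⁾)(m)` attached to a linear family of endomorphisms. -/
noncomputable def coact {k C M : Type*} [CommRing k] [AddCommGroup C] [Module k C] [Coalgebra k C]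
    [AddCommGroup M] [Module k M] (f : C →ₗ[k] Module.End k M) : C ⊗[k] M →ₗ[k] C ⊗[k] M :=
  (TensorProduct.lift f).lTensor C ∘ₗ (TensorProduct.assoc k C C M).toLinearMap ∘ₗ
    (comul (R := k)).rTensor M

/-- The linear map `c ⊗ d ↦ f(c) ∘ g(d)`. -/
noncomputable def tensorEnd {k C M : Type*} [CommRing k] [AddCommGroup C] [Module k C]
    [AddCommGroup M] [Module k M] (f g : C →ₗ[k] Module.End k M) : C ⊗[k] C →ₗ[k] Module.End k M :=
  TensorProduct.lift ((LinearMap.mul k (Module.End k M)).compl₁₂ f g)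

/-- The convolution product `c ↦ f(c⁽¹⁾) ∘ g(c⁽²⁾)`. -/
noncomputable def convEnd {k C M : Type*} [CommRing k] [AddCommGroup C] [Module k C] [Coalgebra k C]
    [AddCommGroup M] [Module k M] (f g : C →ₗ[k] Module.End k M) : C →ₗ[k] Module.End k M :=
  tensorEnd f g ∘ₗ Coalgebra.comul

/-- The unit `c ↦ ε(c) • id` of the convolution product. -/
noncomputable def unitEnd (k C M : Type*) [CommRing k] [AddCommGroup C] [Module k C] [Coalgebra k C]
    [AddCommGroup M] [Module k M] : C →ₗ[k] Module.End k M :=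
  (Coalgebra.counit (R := k)).smulRight LinearMap.id

section

variable {k C M : Type*} [CommRing k] [AddCommGroup C] [Module k C] [AddCommGroup M] [Module k M]

@[simp]
lemma tensorEnd_tmul (f g : C →ₗ[k] Module.End k M) (c d : C) :
    tensorEnd f g (c ⊗ₜ d) = f c * g d := rfl

variable [Coalgebra k C]

lemma coact_tmul (f : C →ₗ[k] Module.End k M) (c : C) (m : M) :
    coact f (c ⊗ₜ m) = (f.flip m).lTensor C (Coalgebra.comul (R := k) c) := by
  simp only [coact, LinearMap.comp_apply, LinearMap.rTensor_tmul]
  induction Coalgebra.comul (R := k) c with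
  | zero => simp
  | add a b ha hb => simp only [TensorProduct.add_tmul, map_add, ha, hb]
  | tmul a b => simp

lemma coact_convEnd_tmul (f g : C →ₗ[k] Module.End k M) (c : C) (m : M) :
    coact (convEnd f g) (c ⊗ₜ m) =
      (LinearMap.applyₗ m ∘ₗ tensorEnd f g).lTensor C (delta3 k c) := by
  rw [coact_tmul, delta3, LinearMap.comp_apply, ← LinearMap.lTensor_comp_apply]
  rfl

lemma coact_comp (f g : C →ₗ[k] Module.End k M) :
    coact f ∘ₗ coact g = coact (convEnd f g) := by
  refine TensorProduct.ext' fun c m => ?_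
  rw [coact_convEnd_tmul, delta3, LinearMap.comp_apply, LinearMap.comp_apply,
    ← Coalgebra.coassoc_apply, coact_tmul]
  induction Coalgebra.comul (R := k) c with
  | zero => simp
  | add a b ha hb => simp only [map_add, ha, hb]
  | tmul a b =>
    rw [LinearMap.lTensor_tmul, coact_tmul, LinearMap.rTensor_tmul]
    induction Coalgebra.comul (R := k) a with
    | zero => simp
    | add a b ha hb => simp only [TensorProduct.add_tmul, map_add, ha, hb]
    | tmul a b => simp

lemma coact_unitEnd : coact (unitEnd k C M) = LinearMap.id := by
  refine TensorProduct.ext' fun c m => ?_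
  have h : (unitEnd k C M).flip m =
      LinearMap.toSpanSingleton k M m ∘ₗ Coalgebra.counit (R := k) := rfl
  rw [coact_tmul, h, LinearMap.lTensor_comp, LinearMap.comp_apply,
    Coalgebra.lTensor_counit_comul]
  simp

lemma convEnd_comm [Coalgebra.IsCocomm k C] {f g : C →ₗ[k] Module.End k M}
    (h : ∀ c d, Commute (f c) (g d)) : convEnd f g = convEnd g f := by
  have h' : tensorEnd g f ∘ₗ (TensorProduct.comm k C C).toLinearMap = tensorEnd f g :=
    TensorProduct.ext' fun c d => (h c d).symm.eq
  rw [convEnd, convEnd, ← h', LinearMap.comp_assoc, Coalgebra.IsCocomm.comm_comp_comul]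

lemma convEnd_rTensor_eq_unitEnd {N : Type*} [AddCommGroup N] [Module k N]
    {f g : C →ₗ[k] Module.End k M} (h : convEnd f g = unitEnd k C M) :
    convEnd (LinearMap.rTensorHom N ∘ₗ f) (LinearMap.rTensorHom N ∘ₗ g) =
      unitEnd k C (M ⊗[k] N) := by
  have h₁ : tensorEnd (LinearMap.rTensorHom N ∘ₗ f) (LinearMap.rTensorHom N ∘ₗ g) =
      LinearMap.rTensorHom N ∘ₗ tensorEnd f g :=
    TensorProduct.ext' fun c d => (LinearMap.rTensor_mul N (f c) (g d)).symm
  rw [convEnd, h₁, LinearMap.comp_assoc, ← convEnd, h]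
  ext c m n
  simp [unitEnd, TensorProduct.smul_tmul']

lemma convEnd_lTensor_eq_unitEnd {N : Type*} [AddCommGroup N] [Module k N]
    {f g : C →ₗ[k] Module.End k M} (h : convEnd f g = unitEnd k C M) :
    convEnd (LinearMap.lTensorHom N ∘ₗ f) (LinearMap.lTensorHom N ∘ₗ g) =
      unitEnd k C (N ⊗[k] M) := by
  have h₁ : tensorEnd (LinearMap.lTensorHom N ∘ₗ f) (LinearMap.lTensorHom N ∘ₗ g) =
      LinearMap.lTensorHom N ∘ₗ tensorEnd f g :=
    TensorProduct.ext' fun c d => (LinearMap.lTensor_mul N (f c) (g d)).symm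
  rw [convEnd, h₁, LinearMap.comp_assoc, ← convEnd, h]
  ext c m n
  simp [unitEnd]

/-- The diagonal family `c ↦ f(c⁽¹⁾) ⊗ f(c⁽²⁾)` of endomorphisms of `M ⊗ M`. -/
noncomputable def diagEnd (f : C →ₗ[k] Module.End k M) : C →ₗ[k] Module.End k (M ⊗[k] M) :=
  convEnd (LinearMap.rTensorHom M ∘ₗ f) (LinearMap.lTensorHom M ∘ₗ f)

lemma coact_diagEnd_comp [Coalgebra.IsCocomm k C] {f g : C →ₗ[k] Module.End k M}
    (h : convEnd f g = unitEnd k C M) :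
    coact (diagEnd f) ∘ₗ coact (diagEnd g) = LinearMap.id := by
  have hc : ∀ c d, Commute ((LinearMap.rTensorHom M ∘ₗ g) c) ((LinearMap.lTensorHom M ∘ₗ g) d) :=
    fun c d => TensorProduct.ext' fun _ _ => rfl
  rw [diagEnd, diagEnd, convEnd_comm hc, ← coact_comp, ← coact_comp, LinearMap.comp_assoc,
    ← LinearMap.comp_assoc (coact (LinearMap.rTensorHom M ∘ₗ g)), coact_comp,
    convEnd_lTensor_eq_unitEnd h, coact_unitEnd, LinearMap.id_comp, coact_comp,
    convEnd_rTensor_eq_unitEnd h, coact_unitEnd]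

end

section

variable {k X : Type*} [CommRing k] [AddCommGroup X] [Module k X]

/-- The right action `c ↦ T(- ⊗ c)`. -/
noncomputable def actEnd (T : X ⊗[k] (X ⊗[k] X) →ₗ[k] X) : X ⊗[k] X →ₗ[k] Module.End k X :=
  (TensorProduct.curry T).flip

/-- The right action `y ⊗ z ↦ T(- ⊗ z ⊗ y)`. -/
noncomputable def actEndSwap (T : X ⊗[k] (X ⊗[k] X) →ₗ[k] X) : X ⊗[k] X →ₗ[k] Module.End k X :=
  actEnd T ∘ₗ (TensorProduct.comm k X X).toLinearMap

@[simp]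
lemma actEnd_apply (T : X ⊗[k] (X ⊗[k] X) →ₗ[k] X) (c : X ⊗[k] X) (x : X) :
    actEnd T c x = T (x ⊗ₜ c) := rfl

@[simp]
lemma actEndSwap_tmul (T : X ⊗[k] (X ⊗[k] X) →ₗ[k] X) (x y z : X) :
    actEndSwap T (y ⊗ₜ z) x = T (x ⊗ₜ (z ⊗ₜ y)) := rfl

variable [Coalgebra k X]

lemma exists_rep2 (x : X) : ∃ (n : ℕ) (x1 x2 : Fin n → X), Rep2 k x x1 x2 :=
  TensorProduct.exists_sum_tmul_eq _

lemma exists_rep3 (x : X) : ∃ (n : ℕ) (x1 x2 x3 : Fin n → X), Rep3 k x x1 x2 x3 := by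
  unfold Rep3
  induction delta3 k x with
  | zero => exact ⟨0, 0, 0, 0, by simp⟩
  | add a b ha hb =>
    obtain ⟨n, a1, a2, a3, rfl⟩ := ha
    obtain ⟨m, b1, b2, b3, rfl⟩ := hb
    exact ⟨n + m, Fin.append a1 b1, Fin.append a2 b2, Fin.append a3 b3, by
      simp [Fin.sum_univ_add]⟩
  | tmul a b =>
    obtain ⟨n, b1, b2, rfl⟩ := TensorProduct.exists_sum_tmul_eq b
    exact ⟨n, fun _ => a, b1, b2, by rw [TensorProduct.tmul_sum]⟩

lemma comul_tmul_of_rep2 {y z : X} {n m : ℕ} {y1 y2 : Fin n → X} {z1 z2 : Fin m → X}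
    (hy : Rep2 k y y1 y2) (hz : Rep2 k z z1 z2) :
    Coalgebra.comul (R := k) (y ⊗ₜ[k] z) =
      ∑ i, ∑ j, (y1 i ⊗ₜ[k] z1 j) ⊗ₜ[k] (y2 i ⊗ₜ[k] z2 j) := by
  unfold Rep2 at hy hz
  simp [hy, hz, TensorProduct.sum_tmul, TensorProduct.tmul_sum]
  exact Finset.sum_comm

lemma delta3_tmul (y z : X) :
    delta3 k (y ⊗ₜ[k] z) =
      (TensorProduct.tensorTensorTensorComm k X X X X).toLinearMap.lTensor (X ⊗[k] X)
        (TensorProduct.tensorTensorTensorComm k X (X ⊗[k] X) X (X ⊗[k] X)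
          (delta3 k y ⊗ₜ[k] delta3 k z)) := by
  simp only [delta3, LinearMap.comp_apply, TensorProduct.comul_tmul,
    TensorProduct.AlgebraTensorModule.tensorTensorTensorComm_eq]
  induction Coalgebra.comul (R := k) y with
  | zero => simp
  | add a b ha hb => simp only [TensorProduct.add_tmul, map_add, ha, hb]
  | tmul a b =>
    induction Coalgebra.comul (R := k) z with
    | zero => simp
    | add a b ha hb => simp only [TensorProduct.tmul_add, map_add, ha, hb]
    | tmul c d => simp [TensorProduct.AlgebraTensorModule.tensorTensorTensorComm_eq]

lemma delta3_tmul_of_rep3 {y z : X} {n m : ℕ} {y1 y2 y3 : Fin n → X} {z1 z2 z3 : Fin m → X}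
    (hy : Rep3 k y y1 y2 y3) (hz : Rep3 k z z1 z2 z3) :
    delta3 k (y ⊗ₜ[k] z) =
      ∑ i, ∑ j, (y1 i ⊗ₜ[k] z1 j) ⊗ₜ[k] ((y2 i ⊗ₜ[k] z2 j) ⊗ₜ[k] (y3 i ⊗ₜ[k] z3 j)) := by
  unfold Rep3 at hy hz
  simp [delta3_tmul, hy, hz, TensorProduct.sum_tmul, TensorProduct.tmul_sum]
  exact Finset.sum_comm

lemma coact_diagEnd_tmul_of_rep3 {M : Type*} [AddCommGroup M] [Module k M]
    (f : X ⊗[k] X →ₗ[k] Module.End k M) {y z : X} {n m : ℕ} {y1 y2 y3 : Fin n → X}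
    {z1 z2 z3 : Fin m → X} (hy : Rep3 k y y1 y2 y3) (hz : Rep3 k z z1 z2 z3) (p q : M) :
    coact (diagEnd f) ((y ⊗ₜ[k] z) ⊗ₜ[k] (p ⊗ₜ[k] q)) =
      ∑ i, ∑ j, (y1 i ⊗ₜ[k] z1 j) ⊗ₜ[k]
        (f (y2 i ⊗ₜ[k] z2 j) p ⊗ₜ[k] f (y3 i ⊗ₜ[k] z3 j) q) := by
  rw [diagEnd, coact_convEnd_tmul, delta3_tmul_of_rep3 hy hz]
  simp

lemma convEnd_actEndSwap_actEnd {T : X ⊗[k] (X ⊗[k] X) →ₗ[k] X} (hT : IsInvertibleTSD k T) :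
    convEnd (actEndSwap T) (actEnd T) = unitEnd k (X ⊗[k] X) X := by
  refine TensorProduct.ext' fun y z => LinearMap.ext fun x => ?_
  obtain ⟨n, y1, y2, hy⟩ := exists_rep2 (k := k) y
  obtain ⟨m, z1, z2, hz⟩ := exists_rep2 (k := k) z
  rw [convEnd, LinearMap.comp_apply, comul_tmul_of_rep2 hy hz]
  simpa [unitEnd, mul_comm] using hT x y z y1 y2 z1 z2 hy hz

lemma convEnd_actEnd_actEndSwap {T : X ⊗[k] (X ⊗[k] X) →ₗ[k] X} (hT : IsInvertibleTSD k T) :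
    convEnd (actEnd T) (actEndSwap T) = unitEnd k (X ⊗[k] X) X := by
  refine TensorProduct.ext' fun y z => LinearMap.ext fun x => ?_
  obtain ⟨n, y1, y2, hy⟩ := exists_rep2 (k := k) y
  obtain ⟨m, z1, z2, hz⟩ := exists_rep2 (k := k) z
  rw [convEnd, LinearMap.comp_apply, comul_tmul_of_rep2 hy hz, Finset.sum_comm]
  simpa [unitEnd] using hT x z y z1 z2 y1 y2 hz hy

end

/-- the doubled braiding `β` is invertible with inverse `β'`. -/
theorem doubled_braiding_invertible (k X : Type*) [CommRing k] [AddCommGroup X]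
    [Module k X] [Coalgebra k X]
    (hcc : ∀ a : X, TensorProduct.comm k X X (Coalgebra.comul a) = Coalgebra.comul a)
    (T : X ⊗[k] (X ⊗[k] X) →ₗ[k] X)
    (hTSD : IsTSD k T) (hTinv : IsInvertibleTSD k T) (hTmor : IsCoalgMor k T)
    (β β' : (X ⊗[k] X) ⊗[k] (X ⊗[k] X) →ₗ[k] (X ⊗[k] X) ⊗[k] (X ⊗[k] X))
    (hβ : ∀ (x x' y z : X) {n m : ℕ} (y1 y2 y3 : Fin n → X) (z1 z2 z3 : Fin m → X),
      Rep3 k y y1 y2 y3 → Rep3 k z z1 z2 z3 →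
      β ((x ⊗ₜ[k] x') ⊗ₜ[k] (y ⊗ₜ[k] z)) =
        ∑ i, ∑ j, (y1 i ⊗ₜ[k] z1 j) ⊗ₜ[k]
          (T (x ⊗ₜ[k] (y2 i ⊗ₜ[k] z2 j)) ⊗ₜ[k] T (x' ⊗ₜ[k] (y3 i ⊗ₜ[k] z3 j))))
    (hβ' : ∀ (y z x x' : X) {n m : ℕ} (y1 y2 y3 : Fin n → X) (z1 z2 z3 : Fin m → X),
      Rep3 k y y1 y2 y3 → Rep3 k z z1 z2 z3 →
      β' ((y ⊗ₜ[k] z) ⊗ₜ[k] (x ⊗ₜ[k] x')) =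
        ∑ i, ∑ j, (T (x ⊗ₜ[k] (z2 j ⊗ₜ[k] y2 i)) ⊗ₜ[k] T (x' ⊗ₜ[k] (z3 j ⊗ₜ[k] y3 i))) ⊗ₜ[k]
          (y1 i ⊗ₜ[k] z1 j)) :
    β ∘ₗ β' = LinearMap.id ∧ β' ∘ₗ β = LinearMap.id := by
  have : Coalgebra.IsCocomm k X := ⟨LinearMap.ext hcc⟩
  have hβ_eq : β = coact (diagEnd (actEnd T)) ∘ₗ
      (TensorProduct.comm k (X ⊗[k] X) (X ⊗[k] X)).toLinearMap := by
    ext x x' y z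
    obtain ⟨n, y1, y2, y3, hy⟩ := exists_rep3 (k := k) y
    obtain ⟨m, z1, z2, z3, hz⟩ := exists_rep3 (k := k) z
    simpa [coact_diagEnd_tmul_of_rep3 _ hy hz] using hβ x x' y z y1 y2 y3 z1 z2 z3 hy hz
  have hβ'_eq : β' = (TensorProduct.comm k (X ⊗[k] X) (X ⊗[k] X)).toLinearMap ∘ₗ
      coact (diagEnd (actEndSwap T)) := by
    ext y z x x'
    obtain ⟨n, y1, y2, y3, hy⟩ := exists_rep3 (k := k) y
    obtain ⟨m, z1, z2, z3, hz⟩ := exists_rep3 (k := k) z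
    simpa [coact_diagEnd_tmul_of_rep3 _ hy hz] using hβ' y z x x' y1 y2 y3 z1 z2 z3 hy hz
  have h₁ := coact_diagEnd_comp (convEnd_actEnd_actEndSwap hTinv)
  have h₂ := coact_diagEnd_comp (convEnd_actEndSwap_actEnd hTinv)
  subst hβ_eq hβ'_eq
  refine ⟨LinearMap.ext fun w => ?_, LinearMap.ext fun w => ?_⟩
  · simpa using LinearMap.congr_fun h₁ w
  · have := LinearMap.congr_fun h₂ (TensorProduct.comm k (X ⊗[k] X) (X ⊗[k] X) w)
    simp only [LinearMap.comp_apply, LinearMap.id_apply, LinearEquiv.coe_coe] at this ⊢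
    rw [this]
    simp
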